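/- arXiv:1612.00597 — 2 statements merged into one kernel-verified Lean document; each statement's English description precedes it below -/
import Mathlib

section
/- Let α ∈ [1, 2] and let W_α = {w ∈ ℂ : w ≠ 0 and |arg w| < απ/2} be the concave wedge domain. If f(z) = a_0 + Σ_{n=1}^∞ a_n z^n is analytic in the open unit disk 𝔻 with f(𝔻) ⊆ W_α and a_0 = f(0) > 0 real, then Σ_{n=1}^∞ |a_n| |z|^n ≤ dist(a_0, ∂W_α) for all z with |z| ≤ r_α = (2^{1/α} − 1)/(2^{1/α} + 1), where dist(a_0, ∂W_α) is the Euclidean distance from a_0 to the boundary of W_α. -/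
/-- The concave wedge domain `W_α = {w ≠ 0 : |arg w| < απ/2}`. -/
def wedge (α : ℝ) : Set ℂ := {w : ℂ | w ≠ 0 ∧ |Complex.arg w| < α * Real.pi / 2}

theorem hasFPowerSeriesOnBall_of_hasSum {c : ℕ → ℂ} {φ : ℂ → ℂ} {r : ℝ} (hr : 0 < r)
    (hφ : ∀ z : ℂ, ‖z‖ < r → HasSum (fun n : ℕ => c n * z ^ n) (φ z)) :
    HasFPowerSeriesOnBall φ (FormalMultilinearSeries.ofScalars ℂ c) 0 (ENNReal.ofReal r) where
  r_le := by
    refine ENNReal.le_of_forall_nnreal_lt fun ρ hρ => ?_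
    have hρ' : (ρ : ℝ) < r := by
      rwa [← ENNReal.ofReal_coe_nnreal, ENNReal.ofReal_lt_ofReal_iff hr] at hρ
    refine FormalMultilinearSeries.le_radius_of_summable _ ?_
    simpa [FormalMultilinearSeries.ofScalars_norm] using
      (hφ (ρ : ℝ) (by simpa using hρ')).summable.norm
  r_pos := by simpa using hr
  hasSum {z} hz := by
    rw [Metric.eball_ofReal, mem_ball_zero_iff] at hz
    simpa [FormalMultilinearSeries.ofScalars_apply_eq, mul_comm] using hφ z hz

theorem coeff_eq_of_hasSum {b c : ℕ → ℂ} {φ : ℂ → ℂ} {r s : ℝ} (hr : 0 < r) (hs : 0 < s)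
    (hb : ∀ z : ℂ, ‖z‖ < r → HasSum (fun n : ℕ => b n * z ^ n) (φ z))
    (hc : ∀ z : ℂ, ‖z‖ < s → HasSum (fun n : ℕ => c n * z ^ n) (φ z)) : b = c := by
  have h := (hasFPowerSeriesOnBall_of_hasSum hr hb).hasFPowerSeriesAt.eq_formalMultilinearSeries
    (hasFPowerSeriesOnBall_of_hasSum hs hc).hasFPowerSeriesAt
  exact FormalMultilinearSeries.ofScalars_series_injective ℂ ℂ h

theorem differentiableOn_of_hasSum {c : ℕ → ℂ} {φ : ℂ → ℂ}
    (hφ : ∀ z : ℂ, ‖z‖ < 1 → HasSum (fun n : ℕ => c n * z ^ n) (φ z)) :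
    DifferentiableOn ℂ φ (Metric.ball 0 1) := by
  have := (hasFPowerSeriesOnBall_of_hasSum one_pos hφ).differentiableOn
  rwa [Metric.eball_ofReal] at this

theorem exists_hasSum_of_differentiableOn {φ : ℂ → ℂ}
    (hφ : DifferentiableOn ℂ φ (Metric.ball 0 1)) :
    ∃ c : ℕ → ℂ, ∀ z : ℂ, ‖z‖ < 1 → HasSum (fun n : ℕ => c n * z ^ n) (φ z) := by
  refine ⟨fun n => (n.factorial : ℂ)⁻¹ * iteratedDeriv n φ 0, fun z hz => ?_⟩
  refine (Complex.hasSum_taylorSeries_on_ball hφ (mem_ball_zero_iff.2 hz)).congr_fun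
    fun n => ?_
  simp only [sub_zero, smul_eq_mul]
  ring

theorem integral_exp_int_mul_I (m : ℤ) :
    ∫ θ in (0 : ℝ)..2 * Real.pi, Complex.exp (m * Complex.I * θ) =
      if m = 0 then 2 * (Real.pi : ℂ) else 0 := by
  split_ifs with h
  · simp [h]
  · have hm : (m : ℂ) * Complex.I ≠ 0 := mul_ne_zero (by exact_mod_cast h) Complex.I_ne_zero
    rw [integral_exp_mul_complex hm]
    have : (m : ℂ) * Complex.I * ((2 * Real.pi : ℝ) : ℂ) = m * (2 * Real.pi * Complex.I) := by
      push_cast; ring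
    rw [this, Complex.exp_int_mul_two_pi_mul_I]
    simp

open Complex in
/-- Fourier coefficients of a power series on a circle of radius `ρ < 1`. -/
theorem hasSum_integral_powerSeries_mul_exp {c : ℕ → ℂ} {φ : ℂ → ℂ}
    (hφ : ∀ z : ℂ, ‖z‖ < 1 → HasSum (fun n : ℕ => c n * z ^ n) (φ z))
    {ρ : ℝ} (hρ0 : 0 ≤ ρ) (hρ1 : ρ < 1) (m : ℤ) :
    HasSum (fun k : ℕ => if (k : ℤ) = m then 2 * Real.pi * (c k * ρ ^ k) else 0)
      (∫ θ in (0 : ℝ)..2 * Real.pi, φ (ρ * exp (θ * I)) * exp (-(m * θ * I))) := by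
  have hnorm (θ : ℝ) : ‖(ρ * exp (θ * I) : ℂ)‖ = ρ := by
    simp [norm_exp_ofReal_mul_I, abs_of_nonneg hρ0]
  have hs : Summable fun k : ℕ => ‖c k‖ * ρ ^ k := by
    have := (hφ ρ (by simpa [abs_of_nonneg hρ0] using hρ1)).summable.norm
    simpa [abs_of_nonneg hρ0] using this
  have hnorm' (θ : ℝ) : ‖exp (-(m * θ * I))‖ = 1 := by
    rw [show -((m : ℂ) * θ * I) = ((-(m * θ) : ℝ) : ℂ) * I by push_cast; ring,
      norm_exp_ofReal_mul_I]
  have key := intervalIntegral.hasSum_integral_of_dominated_convergence (a := 0)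
    (b := 2 * Real.pi) (μ := MeasureTheory.volume)
    (F := fun (k : ℕ) (θ : ℝ) => c k * (ρ * exp (θ * I)) ^ k * exp (-(m * θ * I)))
    (f := fun θ => φ (ρ * exp (θ * I)) * exp (-(m * θ * I)))
    (fun k _ => ‖c k‖ * ρ ^ k)
    (fun k => (Continuous.aestronglyMeasurable (by fun_prop)))
    (fun k => Filter.Eventually.of_forall fun θ _ => by
      rw [norm_mul, norm_mul, norm_pow, hnorm, hnorm', mul_one])
    (Filter.Eventually.of_forall fun θ _ => hs)
    (by simp)
    (Filter.Eventually.of_forall fun θ _ => (hφ _ (by rw [hnorm]; exact hρ1)).mul_right _)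
  refine HasSum.congr_fun key fun k => ?_
  have (θ : ℝ) : c k * (ρ * exp (θ * I)) ^ k * exp (-(m * θ * I)) =
      c k * ρ ^ k * exp (((k - m : ℤ) : ℂ) * I * θ) := by
    rw [mul_pow, ← exp_nat_mul, ← mul_assoc, mul_assoc _ (exp _), ← exp_add]
    congr 2
    push_cast; ring
  simp_rw [this, intervalIntegral.integral_const_mul, integral_exp_int_mul_I, sub_eq_zero]
  split_ifs <;> ring

open Complex ComplexConjugate in
theorem norm_coeff_le_of_norm_le_one {c : ℕ → ℂ} {φ : ℂ → ℂ}
    (hφ : ∀ z : ℂ, ‖z‖ < 1 → HasSum (fun n : ℕ => c n * z ^ n) (φ z))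
    (hb : ∀ z : ℂ, ‖z‖ < 1 → ‖φ z‖ ≤ 1) {n : ℕ} (hn : n ≠ 0) :
    ‖c n‖ ≤ 2 * (1 - ‖c 0‖) := by
  obtain ⟨u, hu, huc⟩ := exists_norm_eq_mul_self (c 0)
  have hd := differentiableOn_of_hasSum hφ
  suffices h : ∀ ρ : ℝ, 0 < ρ → ρ < 1 → ‖c n‖ * ρ ^ n ≤ 2 * (1 - ‖c 0‖) by
    have ht : Filter.Tendsto (fun ρ : ℝ => ‖c n‖ * ρ ^ n) (nhdsWithin 1 (Set.Iio 1))
        (nhds (‖c n‖ * 1 ^ n)) :=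
      (Continuous.tendsto (by fun_prop) 1).mono_left nhdsWithin_le_nhds
    rw [one_pow, mul_one] at ht
    refine le_of_tendsto ht ?_
    filter_upwards [Ioo_mem_nhdsLT (zero_lt_one' ℝ)] with ρ hρ using h ρ hρ.1 hρ.2
  intro ρ hρ0 hρ1
  have hnorm (θ : ℝ) : ‖(ρ * exp (θ * I) : ℂ)‖ < 1 := by
    simpa [norm_exp_ofReal_mul_I, abs_of_pos hρ0] using hρ1
  have hI := hasSum_integral_powerSeries_mul_exp hφ hρ0.le hρ1
  set ψ : ℝ → ℂ := fun θ => u * φ (ρ * exp (θ * I)) with hψ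
  have hψc : Continuous ψ := continuous_const.mul <|
    hd.continuousOn.comp_continuous (by fun_prop) fun θ => mem_ball_zero_iff.2 (hnorm θ)
  have hψ1 (θ : ℝ) : ‖ψ θ‖ ≤ 1 := by
    simpa [hψ, hu] using hb _ (hnorm θ)
  have hpos : ∫ θ in (0 : ℝ)..2 * Real.pi, ψ θ * exp (-(n * θ * I)) =
      u * (2 * Real.pi * (c n * ρ ^ n)) := by
    have h1 := (hI n).unique (hasSum_single n (by intro k hk; simp [hk]))
    simp only [hψ, mul_assoc u, intervalIntegral.integral_const_mul]
    simpa using congrArg (u * ·) h1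
  have hneg : ∫ θ in (0 : ℝ)..2 * Real.pi, conj (ψ θ) * exp (-(n * θ * I)) = 0 := by
    have h1 : ∫ θ in (0 : ℝ)..2 * Real.pi, φ (ρ * exp (θ * I)) * exp (-((-n : ℤ) * θ * I)) = 0 := by
      refine (hI (-n)).unique ?_
      refine HasSum.congr_fun hasSum_zero fun k => ?_
      rw [if_neg (by omega)]
    have h2 : ∫ θ in (0 : ℝ)..2 * Real.pi, ψ θ * exp (n * θ * I) = 0 := by
      simp only [hψ, mul_assoc u, intervalIntegral.integral_const_mul]
      simpa using congrArg (u * ·) h1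
    have h3 := congrArg conj h2
    rw [← intervalIntegral.intervalIntegral_conj, map_zero] at h3
    rw [← h3]
    congr 1 with θ
    simp [← exp_conj]
  have hzero : ∫ θ in (0 : ℝ)..2 * Real.pi, exp (-(n * θ * I)) = 0 := by
    have := integral_exp_int_mul_I (-n)
    rw [if_neg (by omega)] at this
    rw [← this]
    congr 1 with θ
    push_cast
    ring_nf
  have hmean : ∫ θ in (0 : ℝ)..2 * Real.pi, (ψ θ).re = 2 * Real.pi * ‖c 0‖ := by
    have h1 := (hI 0).unique (hasSum_single 0 (by intro k hk; simp [hk]))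
    have h2 : ∫ θ in (0 : ℝ)..2 * Real.pi, ψ θ = ((2 * Real.pi * ‖c 0‖ : ℝ) : ℂ) := by
      simp only [hψ, intervalIntegral.integral_const_mul]
      push_cast
      rw [huc]
      calc _ = u * (2 * Real.pi * c 0) := by simpa using congrArg (u * ·) h1
        _ = _ := by ring
    have h3 := intervalIntegral.intervalIntegral_re (f := ψ) (𝕜 := ℂ) (a := 0) (b := 2 * Real.pi)
      (μ := MeasureTheory.volume) (hψc.intervalIntegrable _ _)
    simp only [h2] at h3
    exact h3.trans (ofReal_re _)
  have hle : ‖∫ θ in (0 : ℝ)..2 * Real.pi, (2 - ψ θ - conj (ψ θ)) * exp (-(n * θ * I))‖ ≤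
      ∫ θ in (0 : ℝ)..2 * Real.pi, (2 - 2 * (ψ θ).re) := by
    refine intervalIntegral.norm_integral_le_of_norm_le (by positivity)
      (Filter.Eventually.of_forall fun θ _ => ?_) (Continuous.intervalIntegrable (by fun_prop) _ _)
    have h1 : (2 - ψ θ - conj (ψ θ)) = ((2 - 2 * (ψ θ).re : ℝ) : ℂ) := by
      rw [sub_sub, add_conj]; push_cast; ring
    have h2 : ‖exp (-(n * θ * I))‖ = 1 := by
      rw [show -((n : ℂ) * θ * I) = ((-(n * θ) : ℝ) : ℂ) * I by push_cast; ring,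
        norm_exp_ofReal_mul_I]
    rw [norm_mul, h1, h2, mul_one, norm_real, Real.norm_of_nonneg]
    linarith [(re_le_norm (ψ θ)).trans (hψ1 θ)]
  have hcj : Continuous fun θ => conj (ψ θ) := continuous_conj.comp hψc
  simp_rw [sub_mul] at hle
  rw [intervalIntegral.integral_sub, intervalIntegral.integral_sub, hpos, hneg,
    intervalIntegral.integral_const_mul, hzero, intervalIntegral.integral_sub,
    intervalIntegral.integral_const_mul, hmean] at hle
  · have hp := Real.pi_pos
    simp [hu, abs_of_pos hp, abs_of_pos hρ0] at hle
    have : (2 * Real.pi) * (‖c n‖ * ρ ^ n) ≤ (2 * Real.pi) * (2 * (1 - ‖c 0‖)) := by linarith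
    exact le_of_mul_le_mul_left this (by positivity)
  all_goals exact Continuous.intervalIntegrable (by fun_prop) _ _

/-- **Bohr's theorem**. -/
theorem bohr_inequality {c : ℕ → ℂ} {φ : ℂ → ℂ}
    (hφ : ∀ z : ℂ, ‖z‖ < 1 → HasSum (fun n : ℕ => c n * z ^ n) (φ z))
    (hb : ∀ z : ℂ, ‖z‖ < 1 → ‖φ z‖ ≤ 1) {r : ℝ} (hr0 : 0 ≤ r) (hr : r ≤ 1 / 3) :
    Summable (fun n => ‖c n‖ * r ^ n) ∧ ∑' n, ‖c n‖ * r ^ n ≤ 1 := by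
  have hs : Summable (fun n => ‖c n‖ * r ^ n) := by
    have := (hφ r (by rw [Complex.norm_real, Real.norm_of_nonneg hr0]; linarith)).summable.norm
    simpa [abs_of_nonneg hr0] using this
  refine ⟨hs, ?_⟩
  have h0 : ‖c 0‖ ≤ 1 := by
    have h1 := (hφ 0 (by simp)).unique (hasSum_single 0 (by intro k hk; simp [hk]))
    simpa [h1] using hb 0 (by simp)
  have hg := (hasSum_geometric_of_lt_one hr0 (by linarith)).mul_left (2 * (1 - ‖c 0‖) * r)
  have htail : ∑' n, ‖c (n + 1)‖ * r ^ (n + 1) ≤ 2 * (1 - ‖c 0‖) * r * (1 - r)⁻¹ := by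
    refine hasSum_le (fun n => ?_) ((summable_nat_add_iff 1).2 hs).hasSum hg
    rw [mul_assoc _ r, ← pow_succ']
    exact mul_le_mul_of_nonneg_right (norm_coeff_le_of_norm_le_one hφ hb n.succ_ne_zero)
      (by positivity)
  rw [hs.tsum_eq_zero_add]
  have h2 : r * (1 - r)⁻¹ ≤ 1 / 2 := by
    rw [← div_eq_mul_inv, div_le_div_iff₀ (by linarith) (by norm_num)]; linarith
  have h3 : 2 * (1 - ‖c 0‖) * (r * (1 - r)⁻¹) ≤ 2 * (1 - ‖c 0‖) * (1 / 2) :=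
    mul_le_mul_of_nonneg_left h2 (by linarith)
  simp only [pow_zero, mul_one]
  linarith

open ComplexOrder in
/-- The Taylor coefficients of `((1 + w) / (1 - w)) ^ α` are nonnegative. -/
theorem exists_nonneg_hasSum_cayley_cpow {α : ℝ} (hα : 0 ≤ α) :
    ∃ A : ℕ → ℝ, (∀ n, 0 ≤ A n) ∧ ∀ w : ℂ, ‖w‖ < 1 →
      HasSum (fun n : ℕ => (A n : ℂ) * w ^ n)
        (Complex.exp (α * Complex.log ((1 + w) / (1 - w)))) := by
  set G : ℂ → ℂ := fun w => Complex.exp (α * Complex.log ((1 + w) / (1 - w))) with hG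
  set K : ℂ → ℂ := fun w => α * ((-1 * w + 1)⁻¹ + (1 * w + 1)⁻¹) with hK
  have hderiv (w : ℂ) (hw : ‖w‖ < 1) : HasDerivAt G (G w * K w) w := by
    have h1 : 1 - w ≠ 0 := fun h => by
      rw [sub_eq_zero] at h; simp [← h] at hw
    have h2 : 1 + w ≠ 0 := fun h => by
      rw [add_eq_zero_iff_eq_neg] at h; rw [← norm_neg, ← h] at hw; simp at hw
    have hs : (1 + w) / (1 - w) ∈ Complex.slitPlane := by
      left
      have hn : Complex.normSq w < 1 := by
        rw [Complex.normSq_eq_norm_sq]; nlinarith [norm_nonneg w]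
      rw [Complex.normSq_apply] at hn
      rw [Complex.div_re, ← add_div]
      refine div_pos ?_ (Complex.normSq_pos.2 h1)
      simp
      nlinarith
    have h3 := ((((hasDerivAt_id w).const_add 1).div ((hasDerivAt_id w).const_sub 1) h1).clog
      hs).const_mul (α : ℂ) |>.cexp
    refine h3.congr_deriv ?_
    simp only [hG, hK, id, Pi.div_apply, neg_one_mul, neg_add_eq_sub, one_mul, add_comm w 1]
    congr 1
    field_simp
    ring
  have hd : DifferentiableOn ℂ G (Metric.ball 0 1) := fun w hw =>
    (hderiv w (mem_ball_zero_iff.1 hw)).differentiableAt.differentiableWithinAt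
  have hGc (n : ℕ) : ContDiffAt ℂ n G 0 :=
    (hd.analyticAt (Metric.ball_mem_nhds 0 one_pos)).contDiffAt
  have hKa : AnalyticAt ℂ K 0 := by
    have h1 : AnalyticAt ℂ (fun w : ℂ => (-1 * w + 1)⁻¹) 0 :=
      AnalyticAt.inv (by fun_prop) (by simp)
    have h2 : AnalyticAt ℂ (fun w : ℂ => (1 * w + 1)⁻¹) 0 :=
      AnalyticAt.inv (by fun_prop) (by simp)
    exact analyticAt_const.mul (h1.add h2)
  have hKn (n : ℕ) : 0 ≤ iteratedDeriv n K 0 := by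
    have h1 : ContDiffAt ℂ n (fun w : ℂ => (-1 * w + 1)⁻¹) 0 :=
      ContDiffAt.inv (by fun_prop) (by simp)
    have h2 : ContDiffAt ℂ n (fun w : ℂ => (1 * w + 1)⁻¹) 0 :=
      ContDiffAt.inv (by fun_prop) (by simp)
    rw [hK, iteratedDeriv_const_mul_field, iteratedDeriv_fun_add h1 h2, iteratedDeriv_eq_iterate,
      iteratedDeriv_eq_iterate, iter_deriv_inv_linear, iter_deriv_inv_linear]
    refine mul_nonneg (by exact_mod_cast hα) ?_
    rcases neg_one_pow_eq_or ℂ n with h | h <;> simp [h]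
    positivity
  have hGn (n : ℕ) : 0 ≤ iteratedDeriv n G 0 := by
    induction n using Nat.strong_induction_on with
    | _ n ih =>
      rcases n with _ | n
      · simp [hG]
      · have he : deriv G =ᶠ[nhds 0] G * K := by
          filter_upwards [Metric.ball_mem_nhds (0 : ℂ) one_pos] with w hw
          exact (hderiv w (mem_ball_zero_iff.1 hw)).deriv
        rw [iteratedDeriv_succ', he.iteratedDeriv_eq, iteratedDeriv_mul (hGc n) hKa.contDiffAt]
        refine Finset.sum_nonneg fun i hi => mul_nonneg (mul_nonneg (by positivity) ?_) (hKn _)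
        exact ih i (Finset.mem_range.1 hi)
  refine ⟨fun n => (n.factorial : ℝ)⁻¹ * (iteratedDeriv n G 0).re, fun n =>
    mul_nonneg (by positivity) (Complex.nonneg_iff.1 (hGn n)).1, fun w hw => ?_⟩
  refine (Complex.hasSum_taylorSeries_on_ball hd (mem_ball_zero_iff.2 hw)).congr_fun
    fun n => ?_
  have : ((iteratedDeriv n G 0).re : ℂ) = iteratedDeriv n G 0 :=
    Complex.ext rfl (by simpa using (Complex.nonneg_iff.1 (hGn n)).2)
  push_cast
  rw [this, sub_zero, smul_eq_mul, smul_eq_mul]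
  ring

/-- Bohr's inequality for subordination: if `F = ∑ Aₖ ωᵏ` with `Aₖ ≥ 0` and `ω` a Schwarz function,
then the majorant series of `F` is at most `∑ Aₖ rᵏ` for `r ≤ 1 / 3`. -/
theorem sum_norm_coeff_comp_le {A : ℕ → ℝ} (hA : ∀ n, 0 ≤ A n) {r S : ℝ} (hr0 : 0 < r)
    (hr : r ≤ 1 / 3) (hAs : HasSum (fun n => A n * r ^ n) S) {ω F : ℂ → ℂ} {a : ℕ → ℂ}
    (hd : DifferentiableOn ℂ ω (Metric.ball 0 1)) (hω0 : ω 0 = 0)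
    (hω : ∀ z : ℂ, ‖z‖ < 1 → ‖ω z‖ < 1)
    (hF : ∀ z : ℂ, ‖z‖ < 1 → HasSum (fun n : ℕ => a n * z ^ n) (F z))
    (hcomp : ∀ z : ℂ, ‖z‖ < 1 → HasSum (fun k : ℕ => (A k : ℂ) * ω z ^ k) (F z)) :
    Summable (fun n => ‖a n‖ * r ^ n) ∧ ∑' n, ‖a n‖ * r ^ n ≤ S := by
  have hφd : DifferentiableOn ℂ (dslope ω 0) (Metric.ball 0 1) :=
    (Complex.differentiableOn_dslope (Metric.ball_mem_nhds 0 one_pos)).2 hd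
  have hφ1 (z : ℂ) (hz : ‖z‖ < 1) : ‖dslope ω 0 z‖ ≤ 1 := by
    simpa using Complex.norm_dslope_le_div_of_mapsTo_ball (R₂ := 1) hd (fun z hz => by
      simpa [hω0] using (hω z (mem_ball_zero_iff.1 hz)).le) (mem_ball_zero_iff.2 hz)
  have hωφ (z : ℂ) : ω z = z * dslope ω 0 z := by
    simpa [hω0] using (sub_smul_dslope ω 0 z).symm
  choose d hdsum using fun k : ℕ => exists_hasSum_of_differentiableOn (hφd.pow k)
  have hbohr (k : ℕ) := bohr_inequality (hdsum k)
    (fun z hz => by simpa using pow_le_one₀ (norm_nonneg _) (hφ1 z hz)) hr0.le hr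
  set N : ℕ × ℕ → ℝ := fun p => A p.1 * ‖d p.1 p.2‖ * r ^ (p.1 + p.2) with hN
  have hN0 : 0 ≤ N := fun p => mul_nonneg (mul_nonneg (hA _) (norm_nonneg _)) (by positivity)
  have hrow (k : ℕ) : HasSum (fun n => N (k, n)) (A k * r ^ k * ∑' n, ‖d k n‖ * r ^ n) := by
    refine HasSum.congr_fun ((hbohr k).1.hasSum.mul_left (A k * r ^ k)) fun n => ?_
    simp only [hN, pow_add]; ring
  have hrow_le (k : ℕ) : A k * r ^ k * ∑' n, ‖d k n‖ * r ^ n ≤ A k * r ^ k :=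
    mul_le_of_le_one_right (mul_nonneg (hA k) (by positivity)) (hbohr k).2
  have hrows : Summable fun k => A k * r ^ k * ∑' n, ‖d k n‖ * r ^ n :=
    hAs.summable.of_nonneg_of_le (fun k => mul_nonneg (mul_nonneg (hA k) (by positivity))
      (tsum_nonneg fun n => by positivity)) hrow_le
  have hNs : Summable N := by
    refine (summable_prod_of_nonneg hN0).2 ⟨fun k => (hrow k).summable, ?_⟩
    simpa only [(hrow _).tsum_eq] using hrows
  have hNle : ∑' p, N p ≤ S := by
    rw [hNs.tsum_prod' fun k => (hrow k).summable]
    simp only [(hrow _).tsum_eq]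
    exact hasSum_le hrow_le hrows.hasSum hAs
  set b : ℕ → ℂ := fun m => ∑ p ∈ Finset.HasAntidiagonal.antidiagonal m, A p.1 * d p.1 p.2 with hb
  have hanti {E : Type} [NormedAddCommGroup E] {f : ℕ × ℕ → E} {s : E}
      (hf : HasSum f s) : HasSum (fun m => ∑ p ∈ Finset.HasAntidiagonal.antidiagonal m, f p) s := by
    refine (Finset.HasAntidiagonal.sigmaAntidiagonalEquivProd.hasSum_iff.2 hf).sigma fun m => ?_
    exact Finset.hasSum (Finset.HasAntidiagonal.antidiagonal m) f
  have hbF (z : ℂ) (hz : ‖z‖ < r) : HasSum (fun m => b m * z ^ m) (F z) := by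
    have hz1 : ‖z‖ < 1 := by linarith
    have hT : Summable fun p : ℕ × ℕ => (A p.1 * d p.1 p.2 * z ^ (p.1 + p.2) : ℂ) := by
      refine hNs.of_norm_bounded fun p => ?_
      rw [norm_mul, norm_mul, norm_pow, Complex.norm_real, Real.norm_of_nonneg (hA _)]
      exact mul_le_mul_of_nonneg_left (pow_le_pow_left₀ (norm_nonneg _) hz.le _)
        (mul_nonneg (hA _) (norm_nonneg _))
    have hTF : ∑' p : ℕ × ℕ, (A p.1 * d p.1 p.2 * z ^ (p.1 + p.2) : ℂ) = F z := by
      refine (hT.hasSum.prod_fiberwise fun k => ?_).unique (hcomp z hz1)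
      rw [hωφ z, mul_pow, ← mul_assoc]
      refine HasSum.congr_fun ((hdsum k z hz1).mul_left (A k * z ^ k : ℂ)) fun n => ?_
      rw [pow_add]; ring
    refine HasSum.congr_fun (hanti (hTF ▸ hT.hasSum)) fun m => ?_
    rw [hb, Finset.sum_mul]
    exact Finset.sum_congr rfl fun p hp => by rw [Finset.HasAntidiagonal.mem_antidiagonal.1 hp]
  have hab : a = b := coeff_eq_of_hasSum one_pos hr0 hF hbF
  have hNa := hanti hNs.hasSum
  have hle (m : ℕ) : ‖a m‖ * r ^ m ≤ ∑ p ∈ Finset.HasAntidiagonal.antidiagonal m, N p := by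
    rw [hab, hb]
    refine (mul_le_mul_of_nonneg_right (norm_sum_le _ _) (by positivity)).trans_eq ?_
    rw [Finset.sum_mul]
    refine Finset.sum_congr rfl fun p hp => ?_
    rw [norm_mul, Complex.norm_real, Real.norm_of_nonneg (hA _), hN,
      ← Finset.HasAntidiagonal.mem_antidiagonal.1 hp]
  have hs : Summable (fun n => ‖a n‖ * r ^ n) :=
    hNa.summable.of_nonneg_of_le (fun n => by positivity) hle
  exact ⟨hs, (hasSum_le hle hs.hasSum hNa).trans hNle⟩

theorem le_infDist_frontier_wedge {α a₀ : ℝ} (hα : 1 ≤ α) :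
    a₀ ≤ Metric.infDist (a₀ : ℂ) (frontier (wedge α)) := by
  have hπ := Real.pi_pos
  have hright {w : ℂ} (hw : 0 < w.re) : w ∈ wedge α := by
    refine ⟨fun h => by simp [h] at hw, ?_⟩
    have := Complex.abs_arg_lt_pi_div_two_iff.2 (Or.inl hw)
    nlinarith
  have h0 : (0 : ℂ) ∈ frontier (wedge α) := by
    refine ⟨?_, fun h => (interior_subset h).1 rfl⟩
    have ht : Filter.Tendsto (fun t : ℝ => (t : ℂ)) (nhdsWithin 0 (Set.Ioi 0)) (nhds 0) := by
      simpa using (Complex.continuous_ofReal.tendsto 0).mono_left nhdsWithin_le_nhds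
    refine mem_closure_of_tendsto ht ?_
    filter_upwards [self_mem_nhdsWithin] with t ht
    exact hright (by simpa using ht)
  refine (Metric.le_infDist ⟨0, h0⟩).2 fun w hw => ?_
  by_contra! hlt
  refine hw.2 (mem_interior.2 ⟨{w | 0 < w.re}, fun _ => hright,
    isOpen_lt continuous_const Complex.continuous_re, ?_⟩)
  rw [dist_eq_norm] at hlt
  have := (Complex.re_le_norm (a₀ - w)).trans_lt hlt
  simp at this
  exact this

/-- A function from the disk to the wedge of opening `απ` is, up to a positive factor, the
composition of `((1 + w) / (1 - w)) ^ α` with a Schwarz function. -/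
theorem exists_schwarz_of_mapsTo_wedge {α : ℝ} (hα1 : 1 ≤ α) (hα2 : α ≤ 2) {f : ℂ → ℂ} {a₀ : ℝ}
    (ha₀ : 0 < a₀) (hd : DifferentiableOn ℂ f (Metric.ball 0 1)) (h0 : f 0 = a₀)
    (hmap : ∀ z : ℂ, ‖z‖ < 1 → f z ∈ wedge α) :
    ∃ ω : ℂ → ℂ, DifferentiableOn ℂ ω (Metric.ball 0 1) ∧ ω 0 = 0 ∧
      (∀ z : ℂ, ‖z‖ < 1 → ‖ω z‖ < 1) ∧
      ∀ z : ℂ, ‖z‖ < 1 →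
        Complex.exp (α * Complex.log ((1 + ω z) / (1 - ω z))) = f z / a₀ := by
  have hπ := Real.pi_pos
  have hα : 0 < α := by linarith
  have hαc : (α : ℂ) ≠ 0 := by exact_mod_cast hα.ne'
  set h : ℂ → ℂ := fun z => (Complex.log (f z) - Real.log a₀) / α with hh
  have him (z : ℂ) (hz : ‖z‖ < 1) : |(h z).im| < Real.pi / 2 := by
    have h1 : (h z).im = Complex.arg (f z) / α := by simp [hh, Complex.log_im]
    rw [h1, abs_div, abs_of_pos hα, div_lt_iff₀ hα]
    linarith [(hmap z hz).2]
  have hslit (z : ℂ) (hz : ‖z‖ < 1) : f z ∈ Complex.slitPlane := by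
    obtain ⟨h1, h2⟩ := hmap z hz
    refine Complex.mem_slitPlane_iff_arg.2 ⟨fun h3 => ?_, h1⟩
    rw [h3, abs_of_pos hπ] at h2
    nlinarith
  have hre (z : ℂ) (hz : ‖z‖ < 1) : 0 < (Complex.exp (h z)).re := by
    rw [Complex.exp_re]
    exact mul_pos (Real.exp_pos _) (Real.cos_pos_of_mem_Ioo (abs_lt.1 (him z hz)))
  have hne (z : ℂ) (hz : ‖z‖ < 1) : Complex.exp (h z) + 1 ≠ 0 := fun h1 => by
    have h2 := congrArg Complex.re h1
    simp only [Complex.add_re, Complex.one_re, Complex.zero_re] at h2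
    linarith [hre z hz]
  have hdh : DifferentiableOn ℂ h (Metric.ball 0 1) :=
    ((hd.clog fun z hz => hslit z (mem_ball_zero_iff.1 hz)).sub_const _).div_const _
  refine ⟨fun z => (Complex.exp (h z) - 1) / (Complex.exp (h z) + 1),
    (hdh.cexp.sub_const _).div (hdh.cexp.add_const _) fun z hz => hne z (mem_ball_zero_iff.1 hz),
    ?_, fun z hz => ?_, fun z hz => ?_⟩
  · simp [hh, h0, Complex.ofReal_log ha₀.le]
  · rw [norm_div, div_lt_one (norm_pos_iff.2 (hne z hz)), ← sq_lt_sq₀ (norm_nonneg _) (norm_nonneg _),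
      Complex.sq_norm, Complex.sq_norm, Complex.normSq_apply, Complex.normSq_apply]
    simp
    nlinarith [hre z hz]
  · have h1 : (1 + (Complex.exp (h z) - 1) / (Complex.exp (h z) + 1)) /
        (1 - (Complex.exp (h z) - 1) / (Complex.exp (h z) + 1)) = Complex.exp (h z) := by
      have := hne z hz
      field_simp
      ring
    have h2 := abs_lt.1 (him z hz)
    rw [h1, Complex.log_exp (by linarith) (by linarith), hh, mul_div_cancel₀ _ hαc, Complex.exp_sub,
      Complex.exp_log (hmap z hz).1, ← Complex.ofReal_exp, Real.exp_log ha₀]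

/-- Bohr radius for the concave wedge domain: let `1 ≤ α ≤ 2` and
`f z = a₀ + ∑_{n≥1} aₙ zⁿ` be analytic in the unit disk with values in `W_α` and
`a₀ = f 0 > 0` real. Then `∑_{n≥1} |aₙ| |z|ⁿ ≤ dist(a₀, ∂W_α)` for
`|z| ≤ r_α = (2^{1/α} - 1)/(2^{1/α} + 1)`. -/
theorem bohr_concave_wedge
    (α : ℝ) (hα1 : 1 ≤ α) (hα2 : α ≤ 2)
    (f : ℂ → ℂ) (a : ℕ → ℂ) (a₀ : ℝ) (ha₀ : 0 < a₀) (h0 : a 0 = (a₀ : ℂ))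
    (hrep : ∀ z : ℂ, ‖z‖ < 1 → HasSum (fun n : ℕ => a n * z ^ n) (f z))
    (hmap : ∀ z : ℂ, ‖z‖ < 1 → f z ∈ wedge α) :
    ∀ z : ℂ, ‖z‖ ≤ ((2 : ℝ) ^ ((1 : ℝ) / α) - 1) / ((2 : ℝ) ^ ((1 : ℝ) / α) + 1) →
      ∑' n : ℕ, ‖a (n + 1)‖ * ‖z‖ ^ (n + 1) ≤
        Metric.infDist (a 0) (frontier (wedge α)) := by
  intro z hz
  have hα : 0 < α := by linarith
  set t : ℝ := (2 : ℝ) ^ ((1 : ℝ) / α) with ht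
  have ht1 : 1 < t := Real.one_lt_rpow one_lt_two (by positivity)
  have ht2 : t ≤ 2 := by
    have := Real.rpow_le_rpow_of_exponent_le one_le_two ((div_le_one hα).2 hα1)
    rwa [Real.rpow_one] at this
  set r : ℝ := (t - 1) / (t + 1) with hr
  have hr0 : 0 < r := div_pos (by linarith) (by linarith)
  have hr3 : r ≤ 1 / 3 := by
    rw [hr, div_le_div_iff₀ (by linarith) (by norm_num)]; linarith
  have hf0 : f 0 = a₀ := by
    have h1 := (hrep 0 (by simp)).unique (hasSum_single 0 (by intro k hk; simp [hk]))
    simpa [h0] using h1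
  obtain ⟨ω, hωd, hω0, hω1, hωf⟩ := exists_schwarz_of_mapsTo_wedge hα1 hα2 ha₀
    (differentiableOn_of_hasSum hrep) hf0 hmap
  obtain ⟨A, hA, hAsum⟩ := exists_nonneg_hasSum_cayley_cpow hα.le
  have hAr : HasSum (fun n => A n * r ^ n) 2 := by
    have h1 := hAsum r (by rw [Complex.norm_real, Real.norm_of_nonneg hr0.le]; linarith)
    have h2 : (1 + (r : ℂ)) / (1 - r) = (t : ℝ) := by
      have : (1 + r) / (1 - r) = t := by
        rw [hr]
        have : t + 1 ≠ 0 := by linarith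
        field_simp
        ring
      exact_mod_cast this
    have h3 : Real.exp (α * Real.log t) = 2 := by
      rw [ht, Real.log_rpow two_pos, ← mul_assoc, mul_one_div_cancel hα.ne', one_mul,
        Real.exp_log two_pos]
    rw [h2, ← Complex.ofReal_log (by linarith), ← Complex.ofReal_mul, ← Complex.ofReal_exp, h3] at h1
    exact_mod_cast h1
  obtain ⟨hs, hle⟩ := sum_norm_coeff_comp_le hA hr0 hr3 hAr hωd hω0 hω1
    (F := fun z => f z / a₀) (a := fun n => a n / a₀)
    (fun z hz => by simpa only [div_mul_eq_mul_div] using (hrep z hz).div_const (a₀ : ℂ))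
    (fun z hz => by simpa only [hωf z hz] using hAsum (ω z) (hω1 z hz))
  have hterm (n : ℕ) : ‖a n‖ * r ^ n = a₀ * (‖a n / a₀‖ * r ^ n) := by
    rw [norm_div, Complex.norm_real, Real.norm_of_nonneg ha₀.le]
    field_simp
  have hs' : Summable (fun n => ‖a n‖ * r ^ n) := by
    simpa only [hterm] using hs.mul_left a₀
  have hle' : ∑' n, ‖a n‖ * r ^ n ≤ a₀ * 2 := by
    simp only [hterm, tsum_mul_left]
    exact mul_le_mul_of_nonneg_left hle ha₀.le
  rw [hs'.tsum_eq_zero_add, h0, Complex.norm_real, Real.norm_of_nonneg ha₀.le, pow_zero,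
    mul_one] at hle'
  rw [h0]
  refine le_trans ?_ (le_infDist_frontier_wedge hα1)
  have hs1 := (summable_nat_add_iff 1).2 hs'
  have hmono (n : ℕ) : ‖a (n + 1)‖ * ‖z‖ ^ (n + 1) ≤ ‖a (n + 1)‖ * r ^ (n + 1) :=
    mul_le_mul_of_nonneg_left (pow_le_pow_left₀ (norm_nonneg _) hz _) (norm_nonneg _)
  have := (hs1.of_nonneg_of_le (fun n => by positivity) hmono).tsum_le_tsum hmono hs1
  linarith
end

section
/- Let n ≥ 1 and let f be holomorphic in the unit polydisk 𝔻ⁿ = {z ∈ ℂⁿ : max_j |z_j| < 1} with power series f(z) = Σ_α c_α z^α (multi-index notation) and |f(z)| < 1 for all z ∈ 𝔻ⁿ. Then Σ_α |c_α| r^{|α|} ≤ 1 for all 0 ≤ r ≤ 1/(3√n); that is, the Bohr radius K_n of the polydisk satisfies K_n ≥ 1/(3√n). Moreover, for n ≥ 2, K_n ≤ 2√((log n)/n): for every r with 2√((log n)/n) < r < 1 there exists a holomorphic f on 𝔻ⁿ with |f| < 1 and Σ_α |c_α| r^{|α|} > 1. -/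
section

open Finset ComplexConjugate

theorem norm_sub_le_norm_one_sub_conj_mul {a w : ℂ} (ha : ‖a‖ ≤ 1) (hw : ‖w‖ ≤ 1) :
    ‖w - a‖ ≤ ‖1 - conj a * w‖ := by
  have ha' : Complex.normSq a ≤ 1 := by rw [Complex.normSq_eq_norm_sq]; nlinarith [norm_nonneg a]
  have hw' : Complex.normSq w ≤ 1 := by rw [Complex.normSq_eq_norm_sq]; nlinarith [norm_nonneg w]
  refine le_of_sq_le_sq ?_ (norm_nonneg _)
  rw [← Complex.normSq_eq_norm_sq, ← Complex.normSq_eq_norm_sq]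
  have key := mul_nonneg (sub_nonneg.2 ha') (sub_nonneg.2 hw')
  simp only [Complex.normSq_apply, Complex.sub_re, Complex.sub_im, Complex.mul_re, Complex.mul_im,
    Complex.conj_re, Complex.conj_im, Complex.one_re, Complex.one_im] at key ⊢
  nlinarith [key]

theorem hasFPowerSeriesOnBall_of_hasSum_s18 {g : ℂ → ℂ} {b : ℕ → ℂ}
    (hs : ∀ w : ℂ, ‖w‖ < 1 → HasSum (fun k => b k * w ^ k) (g w)) :
    HasFPowerSeriesOnBall g (FormalMultilinearSeries.ofScalars ℂ b) 0 1 where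
  r_le := by
    refine ENNReal.le_of_forall_nnreal_lt fun ρ hρ => ?_
    refine FormalMultilinearSeries.le_radius_of_summable _ ?_
    have hρ' : ‖((ρ : ℝ) : ℂ)‖ < 1 := by
      simpa using hρ
    refine (hs _ hρ').summable.norm.congr fun k => ?_
    simp
  r_pos := one_pos
  hasSum := by
    intro w hw
    have hw' : ‖w‖ < 1 := by
      simpa [enorm_eq_nnnorm, ← NNReal.coe_lt_coe] using hw
    simpa [FormalMultilinearSeries.ofScalars_apply_eq, mul_comm] using hs w hw'

theorem norm_coeff_one_le {g : ℂ → ℂ} {b : ℕ → ℂ}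
    (hs : ∀ w : ℂ, ‖w‖ < 1 → HasSum (fun k => b k * w ^ k) (g w))
    (hg : ∀ w : ℂ, ‖w‖ < 1 → ‖g w‖ < 1) :
    ‖b 1‖ ≤ 1 - ‖b 0‖ ^ 2 := by
  have hps := hasFPowerSeriesOnBall_of_hasSum_s18 hs
  have hd : DifferentiableOn ℂ g (Metric.ball 0 1) := by
    have := hps.differentiableOn
    rwa [← ENNReal.ofReal_one, Metric.eball_ofReal] at this
  have h0 : g 0 = b 0 := by
    have := hps.coeff_zero ![]
    simpa [FormalMultilinearSeries.ofScalars_apply_eq] using this.symm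
  have h1 : HasDerivAt g (b 1) 0 := by
    simpa [FormalMultilinearSeries.ofScalars_apply_eq] using hps.hasFPowerSeriesAt.hasDerivAt
  have hb0 : ‖b 0‖ < 1 := h0 ▸ hg 0 (by simp)
  have hne : ∀ w : ℂ, ‖w‖ < 1 → 1 - conj (b 0) * g w ≠ 0 := by
    intro w hw h
    have : ‖conj (b 0) * g w‖ < 1 := by
      rw [norm_mul, Complex.norm_conj]
      nlinarith [norm_nonneg (b 0), norm_nonneg (g w), hg w hw]
    rw [← sub_eq_zero.1 h] at this
    simp at this
  have hpos : 0 < 1 - ‖b 0‖ ^ 2 := by nlinarith [norm_nonneg (b 0)]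
  have hψ := Complex.norm_deriv_le_div_of_mapsTo_ball
    (f := fun w => (g w - b 0) / (1 - conj (b 0) * g w)) (c := 0) (R₁ := 1) (R₂ := 1)
    ((hd.sub_const _).div ((hd.const_mul _).const_sub _)
      fun w hw => hne w (by simpa using hw)) (by
      intro w hw
      have hw : ‖w‖ < 1 := by simpa using hw
      simp only [h0, sub_self, zero_div, Metric.mem_closedBall, dist_zero_right, norm_div]
      exact div_le_one_of_le₀ (norm_sub_le_norm_one_sub_conj_mul hb0.le (hg w hw).le)
        (norm_nonneg _)) one_pos
  have hderiv := (h1.sub_const (b 0)).div ((h1.const_mul (conj (b 0))).const_sub 1) (hne 0 (by simp))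
  have hval : (1 : ℂ) - conj (b 0) * b 0 = ((1 - ‖b 0‖ ^ 2 : ℝ) : ℂ) := by
    rw [Complex.conj_mul']; push_cast; ring
  rw [h0, hval] at hderiv
  have hd' : deriv (fun w => (g w - b 0) / (1 - conj (b 0) * g w)) 0
      = b 1 / ((1 - ‖b 0‖ ^ 2 : ℝ) : ℂ) := by
    refine HasDerivAt.deriv (hderiv.congr_deriv ?_)
    have : ((1 - ‖b 0‖ ^ 2 : ℝ) : ℂ) ≠ 0 := by exact_mod_cast hpos.ne'
    field_simp
    ring
  rw [hd', norm_div, Complex.norm_real, Real.norm_of_nonneg hpos.le, div_one,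
    div_le_one hpos] at hψ
  exact hψ

theorem norm_coeff_le {g : ℂ → ℂ} {b : ℕ → ℂ}
    (hs : ∀ w : ℂ, ‖w‖ < 1 → HasSum (fun k => b k * w ^ k) (g w))
    (hg : ∀ w : ℂ, ‖w‖ < 1 → ‖g w‖ < 1) {m : ℕ} (hm : m ≠ 0) :
    ‖b m‖ ≤ 1 - ‖b 0‖ ^ 2 := by
  have hω := Complex.isPrimitiveRoot_exp m hm
  set ω := Complex.exp (2 * Real.pi * Complex.I / m)
  have hωn : ‖ω‖ = 1 := hω.norm'_eq_one hm
  have hm' : (m : ℂ) ≠ 0 := by exact_mod_cast hm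
  have hmr : (0 : ℝ) < m := by exact_mod_cast Nat.pos_of_ne_zero hm
  have key : ∀ u : ℂ, ‖u‖ < 1 → ∃ s : ℂ, ‖s‖ < 1 ∧ HasSum (fun k => b (m * k) * u ^ k) s := by
    intro u hu
    obtain ⟨w, rfl⟩ : ∃ w : ℂ, w ^ m = u := IsAlgClosed.exists_pow_nat_eq u (Nat.pos_of_ne_zero hm)
    have hw : ‖w‖ < 1 := by
      rw [norm_pow] at hu
      exact (pow_lt_one_iff_of_nonneg (norm_nonneg _) hm).1 hu
    have hl : ∀ l : ℕ, ‖ω ^ l * w‖ < 1 := by intro l; simpa [hωn] using hw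
    refine ⟨(∑ l ∈ range m, g (ω ^ l * w)) / m, ?_, ?_⟩
    · rw [norm_div, Complex.norm_natCast, div_lt_one hmr]
      calc _ ≤ ∑ l ∈ range m, ‖g (ω ^ l * w)‖ := norm_sum_le _ _
        _ < ∑ l ∈ range m, (1 : ℝ) := sum_lt_sum_of_nonempty (by simpa using hm)
            fun l _ => hg _ (hl l)
        _ = m := by simp
    · have h := (hasSum_sum fun l (_ : l ∈ range m) => hs _ (hl l)).div_const (m : ℂ)
      have hinj : Function.Injective (fun k : ℕ => m * k) :=
        fun x y hxy => Nat.eq_of_mul_eq_mul_left (Nat.pos_of_ne_zero hm) hxy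
      have hsum : ∀ k, ∑ l ∈ range m, b k * (ω ^ l * w) ^ k
          = b k * w ^ k * ∑ l ∈ range m, (ω ^ k) ^ l := by
        intro k
        rw [mul_sum]
        refine sum_congr rfl fun l _ => ?_
        rw [mul_pow, ← pow_mul, ← pow_mul, mul_comm l k]; ring
      rw [← hinj.hasSum_iff] at h
      · refine h.congr_fun fun k => ?_
        simp only [Function.comp_apply]
        rw [hsum, pow_mul ω m k, hω.pow_eq_one]
        simp only [one_pow, sum_const, card_range, nsmul_eq_mul, mul_one]
        rw [mul_div_cancel_right₀ _ hm', pow_mul]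
      · intro k hk
        have hk' : ω ^ k ≠ 1 := by
          rw [Ne, hω.pow_eq_one_iff_dvd]
          rintro ⟨q, rfl⟩
          exact hk ⟨q, rfl⟩
        have h3 : (∑ l ∈ range m, (ω ^ k) ^ l) * (ω ^ k - 1) = 0 := by
          rw [geom_sum_mul, ← pow_mul, mul_comm k m, pow_mul, hω.pow_eq_one, one_pow, sub_self]
        rw [hsum, (mul_eq_zero.1 h3).resolve_right (sub_ne_zero.2 hk')]
        simp
  choose! h hh hhs using key
  simpa using norm_coeff_one_le hhs hh

theorem sum_normSq_sum_mul_of_orthogonal {T ι : Type*} [Fintype T] [DecidableEq ι] (S : Finset ι)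
    (e : T → ι → ℂ) (K : ℝ)
    (he : ∀ α ∈ S, ∀ β ∈ S, ∑ t, e t α * conj (e t β) = if α = β then (K : ℂ) else 0)
    (c : ι → ℂ) :
    ∑ t, ‖∑ α ∈ S, c α * e t α‖ ^ 2 = K * ∑ α ∈ S, ‖c α‖ ^ 2 := by
  have : ∑ t, ((‖∑ α ∈ S, c α * e t α‖ ^ 2 : ℝ) : ℂ) = ((K * ∑ α ∈ S, ‖c α‖ ^ 2 : ℝ) : ℂ) := by
    calc _ = ∑ t, ∑ α ∈ S, ∑ β ∈ S, c α * conj (c β) * (e t α * conj (e t β)) := by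
          refine sum_congr rfl fun t _ => ?_
          rw [Complex.ofReal_pow, ← Complex.mul_conj', map_sum, sum_mul_sum]
          refine sum_congr rfl fun α _ => sum_congr rfl fun β _ => ?_
          rw [map_mul]; ring
      _ = ∑ α ∈ S, ∑ β ∈ S, c α * conj (c β) * ∑ t, e t α * conj (e t β) := by
          rw [sum_comm]
          refine sum_congr rfl fun α _ => ?_
          rw [sum_comm]
          refine sum_congr rfl fun β _ => ?_
          rw [mul_sum]
      _ = ∑ α ∈ S, c α * conj (c α) * K := by
          refine sum_congr rfl fun α hα => ?_
          rw [sum_eq_single_of_mem α hα]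
          · rw [he α hα α hα, if_pos rfl]
          · intro β hβ hne
            rw [he α hα β hβ, if_neg hne.symm, mul_zero]
      _ = _ := by
          rw [← sum_mul, mul_comm]
          push_cast
          simp_rw [Complex.mul_conj']
  exact_mod_cast this

theorem IsPrimitiveRoot.sum_pow_mul_conj_pow {N : ℕ} {ω : ℂ} (hω : IsPrimitiveRoot ω N)
    {a b : ℕ} (ha : a < N) (hb : b < N) :
    ∑ x : Fin N, (ω ^ (x : ℕ)) ^ a * conj ((ω ^ (x : ℕ)) ^ b) = if a = b then (N : ℂ) else 0 := by
  have hn : ‖ω‖ = 1 := hω.norm'_eq_one (by omega)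
  have hconj : ω * conj ω = 1 := by rw [Complex.mul_conj', hn]; simp
  have hterm : ∀ x : ℕ, (ω ^ x) ^ a * conj ((ω ^ x) ^ b) = (ω ^ a * conj ω ^ b) ^ x := by
    intro x
    simp only [map_pow, mul_pow, ← pow_mul, mul_comm x]
  rw [Fin.sum_univ_eq_sum_range (fun x => (ω ^ x) ^ a * conj ((ω ^ x) ^ b)) N]
  simp_rw [hterm]
  split_ifs with h
  · subst h
    simp [← mul_pow, hconj]
  · have hne : ω ^ a * conj ω ^ b - 1 ≠ 0 := by
      intro h1
      apply h
      apply hω.pow_inj ha hb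
      calc ω ^ a = ω ^ a * (ω * conj ω) ^ b := by rw [hconj]; simp
        _ = (ω ^ a * conj ω ^ b) * ω ^ b := by rw [mul_pow]; ring
        _ = ω ^ b := by rw [sub_eq_zero.1 h1, one_mul]
    have hz : (∑ x ∈ range N, (ω ^ a * conj ω ^ b) ^ x) * (ω ^ a * conj ω ^ b - 1) = 0 := by
      rw [geom_sum_mul, mul_pow, ← pow_mul, ← pow_mul, mul_comm a, mul_comm b, pow_mul, pow_mul,
        ← map_pow, hω.pow_eq_one]
      simp
    exact (mul_eq_zero.1 hz).resolve_right hne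

theorem sum_normSq_coeff_le {n m : ℕ} (S : Finset (Fin n → ℕ)) (hS : ∀ α ∈ S, ∀ j, α j ≤ m)
    (c : (Fin n → ℕ) → ℂ) {M : ℝ}
    (hM : ∀ z : Fin n → ℂ, (∀ j, ‖z j‖ ≤ 1) → ‖∑ α ∈ S, c α * ∏ j, z j ^ α j‖ ≤ M) :
    ∑ α ∈ S, ‖c α‖ ^ 2 ≤ M ^ 2 := by
  have hω := Complex.isPrimitiveRoot_exp (m + 1) m.succ_ne_zero
  set ω := Complex.exp (2 * Real.pi * Complex.I / ((m + 1 : ℕ) : ℂ))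
  have hn : ‖ω‖ = 1 := hω.norm'_eq_one m.succ_ne_zero
  have horth := sum_normSq_sum_mul_of_orthogonal S
    (fun (t : Fin n → Fin (m + 1)) α => ∏ j, (ω ^ (t j : ℕ)) ^ α j) ((m + 1 : ℝ) ^ n) (by
      intro α hα β hβ
      simp only [map_prod, ← prod_mul_distrib]
      rw [← Fintype.prod_sum fun j (x : Fin (m + 1)) =>
        (ω ^ (x : ℕ)) ^ α j * conj ((ω ^ (x : ℕ)) ^ β j)]
      simp_rw [fun j => hω.sum_pow_mul_conj_pow (Nat.lt_succ_of_le (hS α hα j))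
        (Nat.lt_succ_of_le (hS β hβ j))]
      split_ifs with h
      · simp [h]
      · obtain ⟨j, hj⟩ := Function.ne_iff.1 h
        exact prod_eq_zero (mem_univ j) (if_neg hj)) c
  have hle : ∑ t : Fin n → Fin (m + 1), ‖∑ α ∈ S, c α * ∏ j, (ω ^ (t j : ℕ)) ^ α j‖ ^ 2
      ≤ ∑ t : Fin n → Fin (m + 1), M ^ 2 :=
    sum_le_sum fun t _ => pow_le_pow_left₀ (norm_nonneg _)
      (hM (fun j => ω ^ (t j : ℕ)) fun j => by simp [hn]) 2
  rw [horth] at hle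
  simp only [sum_const, card_univ, Fintype.card_fun, Fintype.card_fin, nsmul_eq_mul] at hle
  push_cast at hle
  exact le_of_mul_le_mul_left hle (by positivity)

theorem card_piAntidiag_univ_le (n m : ℕ) : #(piAntidiag (univ : Finset (Fin n)) m) ≤ n ^ m := by
  have h := sum_pow_eq_sum_piAntidiag (univ : Finset (Fin n)) (fun _ => (1 : ℕ)) m
  simp only [sum_const, card_univ, Fintype.card_fin, smul_eq_mul, mul_one, one_pow,
    prod_const_one] at h
  rw [h, card_eq_sum_ones]
  exact sum_le_sum fun α _ => by
    simpa using! Nat.multinomial_pos univ α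

theorem hasSum_slice {n : ℕ} {f : (Fin n → ℂ) → ℂ} {c : (Fin n → ℕ) → ℂ}
    (hf : ∀ z : Fin n → ℂ, (∀ j, ‖z j‖ < 1) →
      HasSum (fun α : Fin n → ℕ => c α * ∏ j, z j ^ α j) (f z))
    {z : Fin n → ℂ} (hz : ∀ j, ‖z j‖ ≤ 1) {w : ℂ} (hw : ‖w‖ < 1) :
    HasSum (fun m => (∑ α ∈ piAntidiag univ m, c α * ∏ j, z j ^ α j) * w ^ m)
      (f fun j => w * z j) := by
  have h := hf (fun j => w * z j) fun j => by
    rw [norm_mul]; nlinarith [norm_nonneg w, norm_nonneg (z j), hz j]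
  rw [← (Equiv.sigmaFiberEquiv fun α : Fin n → ℕ => ∑ j, α j).hasSum_iff] at h
  refine h.sigma fun m => ?_
  have hfin : HasSum (fun α : piAntidiag (univ : Finset (Fin n)) m =>
      (c α * ∏ j, z j ^ (α : Fin n → ℕ) j) * w ^ m)
      ((∑ α ∈ piAntidiag univ m, c α * ∏ j, z j ^ α j) * w ^ m) := by
    rw [sum_mul, ← sum_coe_sort]
    exact hasSum_fintype _
  rw [← (Equiv.subtypeEquivRight (p := fun α : Fin n → ℕ => ∑ j, α j = m)
    (q := fun α => α ∈ piAntidiag univ m) fun α => by simp).hasSum_iff] at hfin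
  convert hfin using 1
  funext α
  obtain ⟨α, rfl⟩ := α
  simp only [Function.comp_apply, Equiv.sigmaFiberEquiv, Equiv.coe_fn_mk,
    Equiv.subtypeEquivRight_apply_coe, mul_pow, prod_mul_distrib, prod_pow_eq_pow_sum]
  ring

theorem tsum_norm_coeff_mul_pow_le_one {n : ℕ} (hn : 1 ≤ n) {f : (Fin n → ℂ) → ℂ}
    {c : (Fin n → ℕ) → ℂ}
    (hf : ∀ z : Fin n → ℂ, (∀ j, ‖z j‖ < 1) →
      HasSum (fun α : Fin n → ℕ => c α * ∏ j, z j ^ α j) (f z))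
    (hf1 : ∀ z : Fin n → ℂ, (∀ j, ‖z j‖ < 1) → ‖f z‖ < 1)
    {r : ℝ} (hr0 : 0 ≤ r) (hr : r ≤ 1 / (3 * Real.sqrt n)) :
    ∑' α : Fin n → ℕ, ‖c α‖ * r ^ (∑ j, α j) ≤ 1 := by
  set a := ‖c 0‖
  have hP : ∀ m ≠ 0, ∀ z : Fin n → ℂ, (∀ j, ‖z j‖ ≤ 1) →
      ‖∑ α ∈ piAntidiag univ m, c α * ∏ j, z j ^ α j‖ ≤ 1 - a ^ 2 := by
    intro m hm z hz
    have h := norm_coeff_le (fun w hw => hasSum_slice hf hz hw) (fun w hw => hf1 _ fun j => by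
      rw [norm_mul]; nlinarith [norm_nonneg w, norm_nonneg (z j), hz j]) hm
    simpa using h
  have ha0 : 0 ≤ a := norm_nonneg _
  have ha : 0 ≤ 1 - a ^ 2 := (norm_nonneg _).trans (hP 1 one_ne_zero 0 (by simp))
  have hsq : 0 < Real.sqrt n := Real.sqrt_pos.2 (by exact_mod_cast hn)
  have hrs : r * Real.sqrt n ≤ 1 / 3 := by
    rw [le_div_iff₀ (by positivity)] at hr
    linarith
  have hdeg : ∀ m ≠ 0, ∑ α ∈ piAntidiag (univ : Finset (Fin n)) m, ‖c α‖ * r ^ (∑ j, α j)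
      ≤ (1 - a ^ 2) * (1 / 3) ^ m := by
    intro m hm
    have h2 := sum_normSq_coeff_le (m := m) (piAntidiag univ m) (fun α hα j => by
      rw [mem_piAntidiag] at hα
      rw [← hα.1]
      exact single_le_sum (fun _ _ => Nat.zero_le _) (mem_univ j)) c (hP m hm)
    have h3 : ∑ α ∈ piAntidiag (univ : Finset (Fin n)) m, ‖c α‖
        ≤ (1 - a ^ 2) * Real.sqrt n ^ m := by
      refine le_of_sq_le_sq ?_ (by positivity)
      calc _ ≤ (#(piAntidiag (univ : Finset (Fin n)) m) : ℝ) *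
            ∑ α ∈ piAntidiag (univ : Finset (Fin n)) m, ‖c α‖ ^ 2 := sq_sum_le_card_mul_sum_sq
        _ ≤ (n : ℝ) ^ m * (1 - a ^ 2) ^ 2 := by
          gcongr
          exact_mod_cast card_piAntidiag_univ_le n m
        _ = _ := by
          rw [mul_pow, ← pow_mul, mul_comm m 2, pow_mul, Real.sq_sqrt (Nat.cast_nonneg n)]
          ring
    calc _ = (∑ α ∈ piAntidiag (univ : Finset (Fin n)) m, ‖c α‖) * r ^ m := by
          rw [sum_mul]
          refine sum_congr rfl fun α hα => ?_
          rw [(mem_piAntidiag.1 hα).1]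
      _ ≤ (1 - a ^ 2) * Real.sqrt n ^ m * r ^ m := by gcongr
      _ = (1 - a ^ 2) * (r * Real.sqrt n) ^ m := by rw [mul_pow]; ring
      _ ≤ _ := by gcongr
  have hpartial : ∀ M : ℕ, ∑ m ∈ range (M + 1),
      ∑ α ∈ piAntidiag (univ : Finset (Fin n)) m, ‖c α‖ * r ^ (∑ j, α j)
      ≤ a + (1 - a ^ 2) / 2 * (1 - (1 / 3) ^ M) := by
    intro M
    induction M with
    | zero => simp [a]
    | succ M ih =>
      rw [sum_range_succ]
      have := hdeg (M + 1) M.succ_ne_zero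
      rw [pow_succ (1 / 3 : ℝ)] at this ⊢
      linarith
  refine Real.tsum_le_of_sum_le (fun α => by positivity) fun s => ?_
  have hmaps : ∀ α ∈ s, ∑ j, α j ∈ range (s.sup (fun α => ∑ j, α j) + 1) := fun α hα =>
    mem_range.2 (Nat.lt_succ_of_le (le_sup (f := fun α : Fin n → ℕ => ∑ j, α j) hα))
  rw [← sum_fiberwise_of_maps_to hmaps]
  calc _ ≤ _ := sum_le_sum fun m _ => sum_le_sum_of_subset_of_nonneg
        (t := piAntidiag (univ : Finset (Fin n)) m) (fun α hα => by
          simpa using (mem_filter.1 hα).2) fun α _ _ => by positivity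
    _ ≤ _ := hpartial _
    _ ≤ 1 := by
      have : (0 : ℝ) ≤ (1 / 3) ^ s.sup (fun α => ∑ j, α j) := by positivity
      nlinarith [mul_nonneg ha this, sq_nonneg (a - 1)]

theorem sum_mul_prod_succ {k m : ℕ} (A : Fin k → (Fin m → Fin k) → ℂ)
    (z : Fin (m + 1) → Fin k → ℂ) :
    ∑ i : Fin (m + 1) → Fin k, A (i 0) (Fin.tail i) * ∏ j, z j (i j)
      = ∑ y : Fin k, z 0 y * ∑ i : Fin m → Fin k, A y i * ∏ j, z j.succ (i j) := by
  rw [← (Fin.consEquiv fun _ => Fin k).sum_comp, Fintype.sum_prod_type]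
  refine sum_congr rfl fun y _ => ?_
  rw [mul_sum]
  refine sum_congr rfl fun i _ => ?_
  have htail : Fin.tail (Fin.consEquiv (fun _ => Fin k) (y, i)) = i := rfl
  rw [htail]
  simp only [Fin.consEquiv_apply, Fin.cons_zero, Fin.prod_univ_succ, Fin.cons_succ]
  ring

/-- Iterating the discrete Fourier transform of order `k` gives unimodular coefficients of a
multilinear form that is small on the polydisk. -/
theorem exists_unimodular_multilinear (k m : ℕ) (hk : 0 < k) :
    ∃ A : Fin k → (Fin m → Fin k) → ℂ, (∀ x i, ‖A x i‖ = 1) ∧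
      ∀ z : Fin m → Fin k → ℂ, (∀ j x, ‖z j x‖ ≤ 1) →
        ∑ x, ‖∑ i, A x i * ∏ j, z j (i j)‖ ^ 2 ≤ (k : ℝ) ^ (m + 1) := by
  induction m with
  | zero => exact ⟨fun _ _ => 1, by simp, by simp⟩
  | succ m ih =>
    obtain ⟨A, hA, hAz⟩ := ih
    have hω := Complex.isPrimitiveRoot_exp k hk.ne'
    set ω := Complex.exp (2 * Real.pi * Complex.I / k)
    have hn : ‖ω‖ = 1 := hω.norm'_eq_one hk.ne'
    refine ⟨fun x i => (ω ^ (x : ℕ)) ^ (i 0 : ℕ) * A (i 0) (Fin.tail i), ?_, ?_⟩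
    · intro x i
      simp [hn, hA]
    · intro z hz
      have hsplit : ∀ x : Fin k, ∑ i : Fin (m + 1) → Fin k,
          (ω ^ (x : ℕ)) ^ (i 0 : ℕ) * A (i 0) (Fin.tail i) * ∏ j, z j (i j)
          = ∑ y : Fin k, (z 0 y * ∑ i : Fin m → Fin k, A y i * ∏ j, z j.succ (i j)) *
            (ω ^ (x : ℕ)) ^ (y : ℕ) := by
        intro x
        rw [sum_mul_prod_succ fun (y : Fin k) i => (ω ^ (x : ℕ)) ^ (y : ℕ) * A y i]
        simp only [mul_assoc, ← mul_sum]
        exact sum_congr rfl fun y _ => by ring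
      simp_rw [hsplit]
      rw [sum_normSq_sum_mul_of_orthogonal univ
        (fun (x y : Fin k) => (ω ^ (x : ℕ)) ^ (y : ℕ)) k (fun α _ β _ => by
          rw [hω.sum_pow_mul_conj_pow α.2 β.2]
          simp [Fin.ext_iff])]
      rw [pow_succ', pow_succ' (k : ℝ) m]
      gcongr
      rw [← pow_succ']
      refine le_trans (sum_le_sum fun y _ => ?_) (hAz (fun j => z j.succ) fun j x => hz _ _)
      rw [norm_mul, mul_pow]
      exact mul_le_of_le_one_left (by positivity) (pow_le_one₀ (norm_nonneg _) (hz 0 y))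

theorem exists_unimodular_multilinear_lt (k m : ℕ) (hk : 0 < k) :
    ∃ a : (Fin (m + 1) → Fin k) → ℂ, (∀ i, ‖a i‖ = 1) ∧
      ∀ z : Fin (m + 1) → Fin k → ℂ, (∀ j x, ‖z j x‖ < 1) →
        ‖∑ i, a i * ∏ j, z j (i j)‖ ^ 2 < (k : ℝ) ^ (m + 2) := by
  obtain ⟨A, hA, hAz⟩ := exists_unimodular_multilinear k m hk
  refine ⟨fun i => A (i 0) (Fin.tail i), fun i => hA _ _, fun z hz => ?_⟩
  have hkr : (0 : ℝ) < k := by exact_mod_cast hk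
  rw [sum_mul_prod_succ]
  have hz0 : ∑ y : Fin k, ‖z 0 y‖ ^ 2 < k := by
    calc _ < ∑ y : Fin k, (1 : ℝ) := sum_lt_sum_of_nonempty ⟨⟨0, hk⟩, mem_univ _⟩
          fun y _ => pow_lt_one₀ (norm_nonneg _) (hz 0 y) two_ne_zero
      _ = k := by simp
  calc _ ≤ (∑ y : Fin k, ‖z 0 y‖ * ‖∑ i : Fin m → Fin k, A y i * ∏ j, z j.succ (i j)‖) ^ 2 := by
        gcongr
        exact (norm_sum_le _ _).trans_eq (sum_congr rfl fun y _ => norm_mul _ _)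
    _ ≤ (∑ y : Fin k, ‖z 0 y‖ ^ 2) *
        ∑ y : Fin k, ‖∑ i : Fin m → Fin k, A y i * ∏ j, z j.succ (i j)‖ ^ 2 :=
      sum_mul_sq_le_sq_mul_sq _ _ _
    _ ≤ (∑ y : Fin k, ‖z 0 y‖ ^ 2) * (k : ℝ) ^ (m + 1) := by
      gcongr
      exact hAz (fun j => z j.succ) fun j x => (hz _ _).le
    _ < k * (k : ℝ) ^ (m + 1) := by gcongr
    _ = _ := (pow_succ' _ _).symm

theorem exists_lt_tsum_norm_coeff {n k m : ℕ} (hk : 0 < k) (hn : (m + 1) * k ≤ n) {r : ℝ}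
    (hr0 : 0 ≤ r) (hr : 1 < (k : ℝ) ^ m * (r ^ 2) ^ (m + 1)) :
    ∃ (f : (Fin n → ℂ) → ℂ) (c : (Fin n → ℕ) → ℂ),
      (∀ z : Fin n → ℂ, (∀ j, ‖z j‖ < 1) →
        HasSum (fun α : Fin n → ℕ => c α * ∏ j, z j ^ α j) (f z)) ∧
      (∀ z : Fin n → ℂ, (∀ j, ‖z j‖ < 1) → ‖f z‖ < 1) ∧
      1 < ∑' α : Fin n → ℕ, ‖c α‖ * r ^ (∑ j, α j) := by
  obtain ⟨a, ha, haz⟩ := exists_unimodular_multilinear_lt k m hk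
  have hkr : (0 : ℝ) < k := by exact_mod_cast hk
  set e : Fin (m + 1) × Fin k → Fin n := fun p => Fin.castLE hn (finProdFinEquiv p) with he
  have hinj : Function.Injective e :=
    (Fin.castLE_injective hn).comp finProdFinEquiv.injective
  set s : (Fin (m + 1) → Fin k) → Finset (Fin n) := fun i => univ.image fun j => e (j, i j) with hs
  have hinj' : ∀ i : Fin (m + 1) → Fin k, Function.Injective fun j => e (j, i j) :=
    fun i j j' h => (Prod.ext_iff.1 (hinj h)).1
  set φ : (Fin (m + 1) → Fin k) → Fin n → ℕ := fun i p => if p ∈ s i then 1 else 0 with hφ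
  have hφinj : Function.Injective φ := by
    intro i i' h
    funext j
    have hj : e (j, i j) ∈ s i := mem_image_of_mem _ (mem_univ j)
    have hj' : e (j, i j) ∈ s i' := by
      by_contra hcon
      simpa [hφ, hj, hcon] using congrFun h (e (j, i j))
    obtain ⟨j', -, hjj⟩ := mem_image.1 hj'
    have := hinj hjj
    simp only [Prod.mk.injEq] at this
    rw [← this.2, this.1]
  have hprod : ∀ i (z : Fin n → ℂ), ∏ p, z p ^ φ i p = ∏ j, z (e (j, i j)) := by
    intro i z
    simp only [hφ, pow_ite, pow_one, pow_zero, prod_ite_mem, univ_inter]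
    exact prod_image fun j _ j' _ h => hinj' i h
  have hsum : ∀ i, ∑ p, φ i p = m + 1 := by
    intro i
    simp only [hφ, sum_boole, filter_mem_eq_inter, univ_inter, Nat.cast_id]
    rw [card_image_of_injective _ (hinj' i)]
    simp
  set C : ℝ := Real.sqrt ((k : ℝ) ^ (m + 2)) with hC
  have hCpos : 0 < C := Real.sqrt_pos.2 (by positivity)
  have hCsq : C ^ 2 = (k : ℝ) ^ (m + 2) := Real.sq_sqrt (by positivity)
  refine ⟨fun z => ∑ i, a i / C * ∏ j, z (e (j, i j)), Function.extend φ (fun i => a i / C) 0,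
    ?_, ?_, ?_⟩
  · intro z _
    rw [← hφinj.hasSum_iff]
    · refine (hasSum_fintype fun i => a i / C * ∏ j, z (e (j, i j))).congr_fun fun i => ?_
      simp only [Function.comp_apply, hφinj.extend_apply, hprod]
    · intro α hα
      rw [Function.extend_apply' _ _ _ hα]
      simp
  · intro z hz
    have h := haz (fun j x => z (e (j, x))) fun j x => hz _
    rw [← hCsq] at h
    have h := lt_of_pow_lt_pow_left₀ 2 hCpos.le h
    have hfac : ∑ i, a i / C * ∏ j, z (e (j, i j)) = (∑ i, a i * ∏ j, z (e (j, i j))) / C := by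
      rw [sum_div]
      exact sum_congr rfl fun i _ => by ring
    simp only [hfac]
    rwa [norm_div, Complex.norm_real, Real.norm_of_nonneg hCpos.le, div_lt_one hCpos]
  · have hval : HasSum (fun α : Fin n → ℕ =>
        ‖Function.extend φ (fun i => a i / (C : ℂ)) 0 α‖ * r ^ (∑ j, α j))
        ((k : ℝ) ^ (m + 1) * (r ^ (m + 1) / C)) := by
      rw [← hφinj.hasSum_iff]
      · have hterm : ∀ i, ‖Function.extend φ (fun i => a i / (C : ℂ)) 0 (φ i)‖ * r ^ (∑ j, φ i j)
            = r ^ (m + 1) / C := by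
          intro i
          rw [hφinj.extend_apply, hsum, norm_div, ha, Complex.norm_real,
            Real.norm_of_nonneg hCpos.le]
          ring
        refine HasSum.congr_fun ?_ hterm
        convert hasSum_fintype fun _ : Fin (m + 1) → Fin k => r ^ (m + 1) / C using 1
        simp
      · intro α hα
        rw [Function.extend_apply' _ _ _ hα]
        simp
    rw [hval.tsum_eq, ← mul_div_assoc, one_lt_div hCpos]
    refine lt_of_pow_lt_pow_left₀ 2 (by positivity) ?_
    rw [hCsq]
    calc (k : ℝ) ^ (m + 2) < k ^ (m + 2) * (k ^ m * (r ^ 2) ^ (m + 1)) :=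
          lt_mul_of_one_lt_right (by positivity) hr
      _ = _ := by ring

theorem exists_degree_and_size {n : ℕ} (hn : 2 ≤ n) :
    ∃ m k : ℕ, 0 < k ∧ (m + 1) * k ≤ n ∧
      1 ≤ (k : ℝ) ^ m * (4 * (Real.log n / n)) ^ (m + 1) := by
  have hnr : (2 : ℝ) ≤ n := by exact_mod_cast hn
  have hn0 : (0 : ℝ) < n := by linarith
  set L := Real.log n with hL
  have hexpL : Real.exp L = n := Real.exp_log hn0
  have he1 := Real.exp_one_gt_d9
  have he2 := Real.exp_one_lt_d9
  have hexp3 : Real.exp 3 = Real.exp 1 ^ 3 := by rw [← Real.exp_nat_mul]; norm_num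
  rcases le_or_gt 3 L with h3 | h3
  · obtain ⟨m, hm⟩ : ∃ m, ⌊L⌋₊ = m + 1 :=
      Nat.exists_eq_succ_of_ne_zero (Nat.floor_pos.2 (by linarith)).ne'
    have hM3 : 3 ≤ m + 1 := hm ▸ Nat.le_floor (by exact_mod_cast h3)
    have hM3r : (3 : ℝ) ≤ (m + 1 : ℕ) := by exact_mod_cast hM3
    have hML : ((m + 1 : ℕ) : ℝ) ≤ L := hm ▸ Nat.floor_le (by linarith)
    have hLM : L < (m + 1 : ℕ) + 1 := hm ▸ Nat.lt_floor_add_one L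
    set M := m + 1 with hMdef
    have hnM : 8 * ((M : ℝ) - 2) ≤ n := by
      calc 8 * ((M : ℝ) - 2) ≤ Real.exp 1 ^ 3 * (M - 2) := by
            gcongr
            · linarith
            · calc (8 : ℝ) = 2 ^ 3 := by norm_num
                _ ≤ _ := by gcongr; linarith
        _ ≤ Real.exp 3 * Real.exp (M - 3) := by
            rw [hexp3]
            gcongr
            linarith [Real.add_one_le_exp ((M : ℝ) - 3)]
        _ = Real.exp M := by rw [← Real.exp_add]; congr 1; ring
        _ ≤ n := by rw [← hexpL]; exact Real.exp_le_exp.2 hML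
    have hMk : M * (n / M) ≤ n := Nat.mul_div_le n M
    have hMk' : n + 1 ≤ M * (n / M) + M := by
      have := Nat.lt_mul_div_succ n (show 0 < M by omega)
      rw [mul_add, mul_one] at this
      omega
    set k := n / M with hk
    have hMkr : (M : ℝ) * k ≤ n := by exact_mod_cast hMk
    have hMkr' : (n : ℝ) + 1 ≤ M * k + M := by exact_mod_cast hMk'
    have hkpos : 0 < k := by
      have : (0 : ℝ) < M * k := by linarith
      exact_mod_cast pos_of_mul_pos_right this (by positivity)
    have hkr : (0 : ℝ) < k := by exact_mod_cast hkpos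
    refine ⟨m, k, hkpos, hMk, ?_⟩
    have hbase : Real.exp 1 ≤ 4 * (L / n) * k := by
      have h4 : Real.exp 1 * n ≤ 4 * L * k := by
        calc Real.exp 1 * n ≤ 4 * (n + 1 - M) := by nlinarith
          _ ≤ 4 * (M * k) := by linarith
          _ ≤ 4 * (L * k) := by gcongr
          _ = _ := by ring
      calc Real.exp 1 ≤ 4 * L * k / n := (le_div_iff₀ hn0).2 h4
        _ = _ := by ring
    have hkexp : (k : ℝ) ≤ Real.exp 1 ^ M := by
      rw [← Real.exp_nat_mul, mul_one]
      have : (M : ℝ) * k ≤ M * Real.exp M := by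
        calc (M : ℝ) * k ≤ Real.exp L := hexpL ▸ hMkr
          _ ≤ Real.exp (1 + M) := Real.exp_le_exp.2 (by linarith)
          _ = Real.exp 1 * Real.exp M := Real.exp_add _ _
          _ ≤ _ := by gcongr; linarith
      exact le_of_mul_le_mul_left this (by linarith)
    have hfin : (k : ℝ) ≤ (4 * (L / n) * k) ^ M :=
      hkexp.trans (pow_le_pow_left₀ (by positivity) hbase M)
    have : (k : ℝ) * 1 ≤ k * (k ^ m * (4 * (L / n)) ^ M) := by
      calc (k : ℝ) * 1 ≤ (4 * (L / n) * k) ^ M := by rwa [mul_one]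
        _ = _ := by rw [mul_pow, hMdef, pow_succ (k : ℝ)]; ring
    exact le_of_mul_le_mul_left this hkr
  · have hn20 : n ≤ 20 := by
      have : (n : ℝ) < 21 := by
        calc (n : ℝ) = Real.exp L := hexpL.symm
          _ < Real.exp 3 := Real.exp_lt_exp.2 h3
          _ ≤ 2.7183 ^ 3 := by rw [hexp3]; gcongr; linarith
          _ ≤ 21 := by norm_num
      have : n < 21 := by exact_mod_cast this
      omega
    have hlog2 := Real.log_two_gt_d9
    have hmono : ∀ p : ℕ, 2 ^ p ≤ n → p * Real.log 2 ≤ L := by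
      intro p hp
      rw [← Real.log_pow]
      exact Real.log_le_log (by positivity) (by exact_mod_cast hp)
    have hlog3 : n = 3 → 1 ≤ L := by
      rintro rfl
      rw [hL, Real.le_log_iff_exp_le hn0]
      push_cast
      linarith
    have key : ∀ x : ℝ, 0 ≤ x → x ≤ L →
        1 ≤ ((n / 2 : ℕ) : ℝ) * (4 * (x / n)) ^ 2 →
        1 ≤ ((n / 2 : ℕ) : ℝ) ^ 1 * (4 * (L / n)) ^ (1 + 1) := by
      intro x hx hxL h
      rw [pow_one]
      exact h.trans (by gcongr)
    refine ⟨1, n / 2, by omega, by omega, ?_⟩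
    have h8 : 8 ≤ n → 2 ≤ L := fun h => by
      have := hmono 3 h
      push_cast at this
      linarith
    have h4 : 4 ≤ n → 1.38 ≤ L := fun h => by
      have := hmono 2 h
      push_cast at this
      linarith
    have h2 : 0.69 ≤ L := by
      have := hmono 1 hn
      push_cast at this
      linarith
    rcases le_or_gt 8 n with hn8 | hn8
    · refine key 2 (by norm_num) (h8 hn8) ?_
      clear_value L
      clear hmono hlog3 key h8 h4 hL hexpL
      interval_cases n <;> norm_num
    rcases le_or_gt 4 n with hn4 | hn4
    · refine key 1.38 (by norm_num) (h4 hn4) ?_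
      clear_value L
      clear hmono hlog3 key h8 h4 hL hexpL
      interval_cases n <;> norm_num
    rcases eq_or_ne n 3 with hn3 | hn3
    · refine key 1 (by norm_num) (hlog3 hn3) ?_
      rw [hn3]
      norm_num
    · refine key 0.69 (by norm_num) h2 ?_
      obtain rfl : n = 2 := by omega
      norm_num

end


/-- Boas–Khavinson bounds for the Bohr radius `K_n` of the unit polydisk:
if `f z = ∑_α c_α z^α` is holomorphic in `𝔻ⁿ` with `|f| < 1`, then
`∑_α |c_α| r^{|α|} ≤ 1` for `0 ≤ r ≤ 1/(3√n)` (so `K_n ≥ 1/(3√n)`); and for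
`n ≥ 2` and every `r` with `2√((log n)/n) < r < 1` there is such an `f` with
`∑_α |c_α| r^{|α|} > 1` (so `K_n ≤ 2√((log n)/n)`). -/
theorem bohr_polydisk_boas_khavinson :
    (∀ (n : ℕ), 1 ≤ n → ∀ (f : (Fin n → ℂ) → ℂ) (c : (Fin n → ℕ) → ℂ),
      (∀ z : Fin n → ℂ, (∀ j, ‖z j‖ < 1) →
        HasSum (fun α : Fin n → ℕ => c α * ∏ j, z j ^ α j) (f z)) →
      (∀ z : Fin n → ℂ, (∀ j, ‖z j‖ < 1) → ‖f z‖ < 1) →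
      ∀ r : ℝ, 0 ≤ r → r ≤ 1 / (3 * Real.sqrt n) →
        ∑' α : Fin n → ℕ, ‖c α‖ * r ^ (∑ j, α j) ≤ 1) ∧
    (∀ (n : ℕ), 2 ≤ n → ∀ r : ℝ, 2 * Real.sqrt (Real.log n / n) < r → r < 1 →
      ∃ (f : (Fin n → ℂ) → ℂ) (c : (Fin n → ℕ) → ℂ),
        (∀ z : Fin n → ℂ, (∀ j, ‖z j‖ < 1) →
          HasSum (fun α : Fin n → ℕ => c α * ∏ j, z j ^ α j) (f z)) ∧
        (∀ z : Fin n → ℂ, (∀ j, ‖z j‖ < 1) → ‖f z‖ < 1) ∧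
        1 < ∑' α : Fin n → ℕ, ‖c α‖ * r ^ (∑ j, α j)) := by
  refine ⟨fun n hn f c hf hf1 r hr0 hr => tsum_norm_coeff_mul_pow_le_one hn hf hf1 hr0 hr,
    fun n hn r hr _ => ?_⟩
  have hL : 0 < Real.log n / n := by
    have : (1 : ℝ) < n := by exact_mod_cast hn
    exact div_pos (Real.log_pos this) (by linarith)
  have hr0 : 0 ≤ r := (by positivity : (0 : ℝ) ≤ 2 * Real.sqrt (Real.log n / n)).trans hr.le
  obtain ⟨m, k, hk, hmk, hkm⟩ := exists_degree_and_size hn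
  refine exists_lt_tsum_norm_coeff hk hmk hr0 (hkm.trans_lt ?_)
  have hr2 : 4 * (Real.log n / n) < r ^ 2 := by
    calc 4 * (Real.log n / n) = (2 * Real.sqrt (Real.log n / n)) ^ 2 := by
          rw [mul_pow, Real.sq_sqrt hL.le]; norm_num
      _ < r ^ 2 := by gcongr
  have hkr : (0 : ℝ) < k := by exact_mod_cast hk
  gcongr
end
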